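/- Let F be a field and C ⊆ F^{m×n} a linear code of dimension k ≥ 1. Then there exists a linear code C' ⊆ F^{m×n'} that is security equivalent to C if and only if n' ≥ d_{M,k}(C). -/

import Mathlib

noncomputable section

open Matrix

variable {F : Type*} [Field F]

/-- The row space of a matrix: the span of its rows. -/
def rowSpace {m n : ℕ} (C : Matrix (Fin m) (Fin n) F) : Submodule F (Fin n → F) :=
  Submodule.span F (Set.range C)

/-- The rank support space of a subspace `L ⊆ F^n`:
all `m × n` matrices whose row space is contained in `L`. -/
def rss (m : ℕ) {n : ℕ} (L : Submodule F (Fin n → F)) :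
    Submodule F (Matrix (Fin m) (Fin n) F) where
  carrier := {V | rowSpace V ≤ L}
  add_mem' := by
    intro a b ha hb
    simp only [Set.mem_setOf_eq, rowSpace, Submodule.span_le] at *
    rintro x ⟨i, rfl⟩
    exact L.add_mem (ha (Set.mem_range_self i)) (hb (Set.mem_range_self i))
  zero_mem' := by
    simp only [Set.mem_setOf_eq, rowSpace, Submodule.span_le]
    rintro x ⟨i, rfl⟩
    exact L.zero_mem
  smul_mem' := by
    intro c a ha
    simp only [Set.mem_setOf_eq, rowSpace, Submodule.span_le] at *
    rintro x ⟨i, rfl⟩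
    exact L.smul_mem c (ha (Set.mem_range_self i))

/-- A rank support space in `F^{m×n}` is any subspace of the form `rss m L`. -/
def IsRSS {m n : ℕ} (V : Submodule F (Matrix (Fin m) (Fin n) F)) : Prop :=
  ∃ L : Submodule F (Fin n → F), V = rss m L

/-- The `r`-th relative generalized matrix weight of a pair of nested linear codes. -/
def dM {m n : ℕ} (C₁ C₂ : Submodule F (Matrix (Fin m) (Fin n) F)) (r : ℕ) : ℕ :=
  sInf { d | ∃ L : Submodule F (Fin n → F), Module.finrank F L = d ∧
    Module.finrank F ↥(C₁ ⊓ rss m L) - Module.finrank F ↥(C₂ ⊓ rss m L) ≥ r }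

/-- The `r`-th generalized matrix weight of a single linear code. -/
def dGMW {m n : ℕ} (C : Submodule F (Matrix (Fin m) (Fin n) F)) (r : ℕ) : ℕ :=
  dM C ⊥ r

/-- The image of a subspace `U ≤ V` under a vector space isomorphism `φ : V ≃ W`,
viewed as a subspace of the ambient space of `W`. -/
def mapThrough {M₁ M₂ : Type*} [AddCommGroup M₁] [Module F M₁] [AddCommGroup M₂] [Module F M₂]
    {V : Submodule F M₁} {W : Submodule F M₂} (φ : V ≃ₗ[F] W) (U : Submodule F M₁) :
    Submodule F M₂ :=
  Submodule.map (W.subtype.comp φ.toLinearMap) (U.comap V.subtype)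

/-- Two linear codes `C ⊆ F^{m×n}` and `C' ⊆ F^{m×n'}` are security equivalent if there are rank
support spaces `V ⊇ C` and `W ⊇ C'` and a security equivalence `φ : V → W` with `φ(C) = C'`. -/
def SecEquiv {m n n' : ℕ} (C : Submodule F (Matrix (Fin m) (Fin n) F))
    (C' : Submodule F (Matrix (Fin m) (Fin n') F)) : Prop :=
  ∃ (V : Submodule F (Matrix (Fin m) (Fin n) F))
    (W : Submodule F (Matrix (Fin m) (Fin n') F)),
    IsRSS V ∧ IsRSS W ∧ C ≤ V ∧ C' ≤ W ∧
    ∃ φ : V ≃ₗ[F] W,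
      (∀ U : Submodule F (Matrix (Fin m) (Fin n) F), U ≤ V →
        (IsRSS U ↔ IsRSS (mapThrough φ U))) ∧
      mapThrough φ C = C'

lemma mem_rss {m n : ℕ} {L : Submodule F (Fin n → F)} {A : Matrix (Fin m) (Fin n) F} :
    A ∈ rss m L ↔ ∀ i, A i ∈ L :=
  Submodule.span_le.trans Set.range_subset_iff

/-- A matrix in `rss m L` is the same thing as an `m`-tuple of vectors of `L`. -/
def rssEquivPi (m : ℕ) {n : ℕ} (L : Submodule F (Fin n → F)) :
    rss m L ≃ₗ[F] (Fin m → L) where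
  toFun A i := ⟨A.1 i, mem_rss.1 A.2 i⟩
  invFun v := ⟨fun i => (v i : Fin n → F), mem_rss.2 fun i => (v i).2⟩
  map_add' _ _ := rfl
  map_smul' _ _ := rfl
  left_inv _ := rfl
  right_inv _ := rfl

lemma finrank_rss (m : ℕ) {n : ℕ} (L : Submodule F (Fin n → F)) :
    Module.finrank F (rss m L) = m * Module.finrank F L := by
  rw [(rssEquivPi m L).finrank_eq, Module.finrank_pi_fintype]
  simp

/-- The isomorphism of rank support spaces applying `e` to every row. -/
def rssCongr (m : ℕ) {n n' : ℕ} {L : Submodule F (Fin n → F)} {L' : Submodule F (Fin n' → F)}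
    (e : L ≃ₗ[F] L') : rss m L ≃ₗ[F] rss m L' :=
  (rssEquivPi m L).trans ((LinearEquiv.piCongrRight fun _ => e).trans (rssEquivPi m L').symm)

section mapThrough

variable {M₁ M₂ : Type*} [AddCommGroup M₁] [Module F M₁] [AddCommGroup M₂] [Module F M₂]
  {V : Submodule F M₁} {W : Submodule F M₂}

lemma mem_mapThrough (φ : V ≃ₗ[F] W) (U : Submodule F M₁) (y : M₂) :
    y ∈ mapThrough φ U ↔ ∃ h : y ∈ W, (φ.symm ⟨y, h⟩ : M₁) ∈ U := by
  constructor
  · rintro ⟨x, hx, rfl⟩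
    exact ⟨(φ x).2, by simpa using hx⟩
  · rintro ⟨h, hU⟩
    exact ⟨φ.symm ⟨y, h⟩, hU, by simp⟩

lemma mapThrough_le (φ : V ≃ₗ[F] W) (U : Submodule F M₁) : mapThrough φ U ≤ W :=
  fun y hy => ((mem_mapThrough φ U y).1 hy).1

lemma mapThrough_symm_mapThrough (φ : V ≃ₗ[F] W) {U : Submodule F M₁} (hU : U ≤ V) :
    mapThrough φ.symm (mapThrough φ U) = U := by
  ext x
  simp only [mem_mapThrough, LinearEquiv.symm_symm, Subtype.coe_eta, LinearEquiv.symm_apply_apply]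
  exact ⟨fun ⟨_, _, h⟩ => h, fun h => ⟨hU h, (φ ⟨x, hU h⟩).2, h⟩⟩

end mapThrough

lemma mapThrough_rssCongr {m n n' : ℕ} {L : Submodule F (Fin n → F)}
    {L' : Submodule F (Fin n' → F)} (e : L ≃ₗ[F] L') (K : Submodule F (Fin n → F)) :
    mapThrough (rssCongr m e) (rss m K) = rss m (mapThrough e K) := by
  ext A
  simp only [mem_mapThrough, mem_rss]
  exact ⟨fun ⟨h, hK⟩ i => ⟨h i, hK i⟩, fun h => ⟨fun i => (h i).1, fun i => (h i).2⟩⟩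

lemma IsRSS.mapThrough_rssCongr {m n n' : ℕ} {L : Submodule F (Fin n → F)}
    {L' : Submodule F (Fin n' → F)} (e : L ≃ₗ[F] L')
    {U : Submodule F (Matrix (Fin m) (Fin n) F)} (hU : IsRSS U) :
    IsRSS (mapThrough (rssCongr m e) U) := by
  obtain ⟨K, rfl⟩ := hU
  exact ⟨_, _root_.mapThrough_rssCongr e K⟩

lemma secEquiv_mapThrough_rssCongr {m n n' : ℕ} {L : Submodule F (Fin n → F)}
    {L' : Submodule F (Fin n' → F)} (e : L ≃ₗ[F] L')
    {C : Submodule F (Matrix (Fin m) (Fin n) F)} (hC : C ≤ rss m L) :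
    SecEquiv C (mapThrough (rssCongr m e) C) := by
  refine ⟨rss m L, rss m L', ⟨L, rfl⟩, ⟨L', rfl⟩, hC, mapThrough_le _ _, rssCongr m e,
    fun U hU => ⟨fun h => h.mapThrough_rssCongr e, fun h => ?_⟩, rfl⟩
  rw [← mapThrough_symm_mapThrough (rssCongr m e) hU]
  exact h.mapThrough_rssCongr e.symm

/-- The last generalized matrix weight is the least dimension of a supporting row space. -/
lemma dGMW_finrank_le_iff {m n : ℕ} (C : Submodule F (Matrix (Fin m) (Fin n) F)) (d : ℕ) :
    dGMW C (Module.finrank F C) ≤ d ↔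
      ∃ L : Submodule F (Fin n → F), C ≤ rss m L ∧ Module.finrank F L ≤ d := by
  have key (L : Submodule F (Fin n → F)) :
      Module.finrank F ↥(C ⊓ rss m L) -
        Module.finrank F ↥((⊥ : Submodule F (Matrix (Fin m) (Fin n) F)) ⊓ rss m L) ≥
          Module.finrank F C ↔ C ≤ rss m L := by
    rw [bot_inf_eq, finrank_bot, Nat.sub_zero]
    refine ⟨fun h => ?_, fun h => by rw [inf_eq_left.2 h]⟩
    exact inf_eq_left.1 (Submodule.eq_of_le_of_finrank_le inf_le_left h)
  simp only [dGMW, dM, key]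
  constructor
  · intro h
    obtain ⟨L, hL, hC⟩ := Nat.sInf_mem
      (s := {d | ∃ L : Submodule F (Fin n → F), Module.finrank F L = d ∧ C ≤ rss m L})
      ⟨_, ⊤, rfl, fun _ _ => mem_rss.2 fun _ => trivial⟩
    exact ⟨L, hC, hL.trans_le h⟩
  · rintro ⟨L, hC, hL⟩
    refine le_trans (Nat.sInf_le ?_) hL
    exact ⟨L, rfl, hC⟩

/-- For a linear code `C ⊆ F^{m×n}` of dimension `k ≥ 1`, there exists a linear
code `C' ⊆ F^{m×n'}` security equivalent to `C` if and only if `n' ≥ d_{M,k}(C)`. -/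
theorem stmt_15 (m n n' : ℕ) (C : Submodule F (Matrix (Fin m) (Fin n) F)) (k : ℕ)
    (hk : Module.finrank F ↥C = k) (hk1 : 1 ≤ k) :
    (∃ C' : Submodule F (Matrix (Fin m) (Fin n') F), SecEquiv C C') ↔ dGMW C k ≤ n' := by
  subst hk
  rw [dGMW_finrank_le_iff]
  constructor
  · rintro ⟨C', V, W, ⟨L, rfl⟩, ⟨L', rfl⟩, hC, -, φ, -, -⟩
    have hm : 0 < m := by
      have h := hk1.trans (Submodule.finrank_mono hC)
      rw [finrank_rss] at h
      exact Nat.pos_of_mul_pos_right h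
    have h := φ.finrank_eq
    rw [finrank_rss, finrank_rss] at h
    refine ⟨L, hC, (Nat.eq_of_mul_eq_mul_left hm h).trans_le ?_⟩
    simpa using L'.finrank_le
  · rintro ⟨L, hC, hL⟩
    obtain ⟨f, hf⟩ := (finrank_le_iff_exists_linearMap (R := F) (M := L) (M' := Fin n' → F)).1
      (by simpa using hL)
    exact ⟨_, secEquiv_mapThrough_rssCongr (LinearEquiv.ofInjective f hf) hC⟩

end
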